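/- arXiv:2509.16234 — 5 statements merged into one kernel-verified Lean document; each statement's English description precedes it below -/
import Mathlib

section
/- Let m and n be coprime positive integers and let f ∈ ℤ[X]. If there exists x ∈ ZMod m that is a periodic point of F_m of minimal period k, and there exists y ∈ ZMod n that is a periodic point of F_n of minimal period l, then there exists z ∈ ZMod (m·n) that is a periodic point of F_{m·n} of minimal period lcm(k, l). -/
/-- The map on `ZMod m` induced by a polynomial `f ∈ ℤ[X]`. -/
noncomputable def polyMap (m : ℕ) (f : Polynomial ℤ) : ZMod m → ZMod m :=
  fun x => Polynomial.aeval x f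

open Function

theorem Function.Semiconj.minimalPeriod_apply_of_injective {α β : Type*} {e : α → β} {f : α → α}
    {g : β → β} (h : Semiconj e f g) (he : Injective e) (x : α) :
    minimalPeriod g (e x) = minimalPeriod f x :=
  Nat.dvd_right_iff_eq.mp fun j => by
    rw [← isPeriodicPt_iff_minimalPeriod_dvd, ← isPeriodicPt_iff_minimalPeriod_dvd, IsPeriodicPt,
      IsPeriodicPt, IsFixedPt, IsFixedPt, ← (h.iterate_right j).eq, he.eq_iff]

theorem RingHom.semiconj_polyMap {m n : ℕ} (φ : ZMod m →+* ZMod n) (f : Polynomial ℤ) :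
    Semiconj φ (polyMap m f) (polyMap n f) := fun x =>
  (Polynomial.aeval_algHom_apply φ.toIntAlgHom x f).symm

theorem ZMod.chineseRemainder_semiconj_polyMap {m n : ℕ} (h : m.Coprime n) (f : Polynomial ℤ) :
    Semiconj (ZMod.chineseRemainder h) (polyMap (m * n) f)
      (Prod.map (polyMap m f) (polyMap n f)) := fun x =>
  Prod.ext
    (((RingHom.fst _ _).comp (ZMod.chineseRemainder h).toRingHom).semiconj_polyMap f x)
    (((RingHom.snd _ _).comp (ZMod.chineseRemainder h).toRingHom).semiconj_polyMap f x)

/-- If `m, n` are coprime positive integers, `F_m` has a periodic point of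
minimal period `k` and `F_n` has a periodic point of minimal period `l`, then `F_{m·n}` has
a periodic point of minimal period `lcm(k, l)`. -/
theorem exists_cycle_lcm (m n : ℕ) (hm : 0 < m) (hn : 0 < n) (h : Nat.Coprime m n)
    (f : Polynomial ℤ) (k l : ℕ)
    (hx : ∃ x : ZMod m, x ∈ Function.periodicPts (polyMap m f) ∧
      Function.minimalPeriod (polyMap m f) x = k)
    (hy : ∃ y : ZMod n, y ∈ Function.periodicPts (polyMap n f) ∧
      Function.minimalPeriod (polyMap n f) y = l) :
    ∃ z : ZMod (m * n), z ∈ Function.periodicPts (polyMap (m * n) f) ∧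
      Function.minimalPeriod (polyMap (m * n) f) z = Nat.lcm k l := by
  obtain ⟨x, hxp, rfl⟩ := hx
  obtain ⟨y, hyp, rfl⟩ := hy
  let e := ZMod.chineseRemainder h
  have key : minimalPeriod (polyMap (m * n) f) (e.symm (x, y)) =
      Nat.lcm (minimalPeriod (polyMap m f) x) (minimalPeriod (polyMap n f) y) := by
    rw [← (ZMod.chineseRemainder_semiconj_polyMap h f).minimalPeriod_apply_of_injective e.injective,
      e.apply_symm_apply, minimalPeriod_prodMap]
  refine ⟨e.symm (x, y), ?_, key⟩
  rw [← minimalPeriod_pos_iff_mem_periodicPts, key]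
  exact Nat.lcm_pos (minimalPeriod_pos_of_mem_periodicPts hxp)
    (minimalPeriod_pos_of_mem_periodicPts hyp)
end

section
/- Let p be a prime, n ≥ 1, f ∈ ℤ[X], and let v ∈ ZMod p^n be a periodic point of F_{p^n} of minimal period k with λ̄(v) = 0 in ZMod p. Then there exists exactly one lift w ∈ ZMod p^{n+1} of v (i.e., π(w) = v) that is a periodic point of F_{p^{n+1}}, and this w has minimal period k. -/
/-- The multiplier `λ(v) = ∏_{i=0}^{k-1} f'(F_m^i(v)) ∈ ZMod m` of a periodic point `v`
of minimal period `k`. -/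
noncomputable def multiplier (m : ℕ) (f : Polynomial ℤ) (k : ℕ) (v : ZMod m) : ZMod m :=
  ∏ i ∈ Finset.range k, Polynomial.aeval ((polyMap m f)^[i] v) (Polynomial.derivative f)

open Function in
/-- If a semiconjugacy collapses, after `k = minimalPeriod F v` steps, the fibre over the periodic
point `v` to a single point, then the fibre contains exactly one periodic point, of minimal
period `k`. -/
theorem existsUnique_periodic_lift_of_collapse {α β : Type*} {G : α → α} {F : β → β} {π : α → β}
    (hπ : Semiconj π G F) (hsurj : Surjective π) {v : β} (hv : v ∈ periodicPts F)
    (hcol : ∀ x y, π x = v → π y = v → G^[minimalPeriod F v] x = G^[minimalPeriod F v] y) :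
    (∃! w, π w = v ∧ w ∈ periodicPts G) ∧
      ∀ w, π w = v → w ∈ periodicPts G → minimalPeriod G w = minimalPeriod F v := by
  set k := minimalPeriod F v with hk
  have hkpos : 0 < k := minimalPeriod_pos_of_mem_periodicPts hv
  have hfib : ∀ x, π x = v → π (G^[k] x) = v := fun x hx => by
    rw [(hπ.iterate_right k).eq, hx]
    exact isPeriodicPt_minimalPeriod F v
  obtain ⟨x, hx⟩ := hsurj v
  have hc : IsPeriodicPt G k (G^[k] x) := hcol _ _ (hfib x hx) hx
  have huniq : ∀ w, π w = v → w ∈ periodicPts G → w = G^[k] x := by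
    rintro w hw ⟨m, hm, hmw⟩
    have hdvd : k ∣ m := (hw ▸ hmw.map hπ : IsPeriodicPt F m v).minimalPeriod_dvd
    obtain ⟨j, rfl⟩ := hdvd
    obtain ⟨i, rfl⟩ := Nat.exists_eq_succ_of_ne_zero (Nat.pos_of_mul_pos_left hm).ne'
    have h : G^[k * i] (G^[k] w) = w := by
      rw [← iterate_add_apply]
      exact hmw
    rw [hcol w x hw hx, (hc.mul_const i).eq] at h
    exact h.symm
  refine ⟨⟨_, ⟨hfib x hx, mk_mem_periodicPts hkpos hc⟩, fun w hw => huniq w hw.1 hw.2⟩, ?_⟩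
  intro w hw hwp
  refine Nat.dvd_antisymm ?_ ?_
  · rw [huniq w hw hwp]
    exact hc.minimalPeriod_dvd
  · have h : IsPeriodicPt F (minimalPeriod G w) v :=
      hw ▸ (isPeriodicPt_minimalPeriod G w).map hπ
    exact h.minimalPeriod_dvd

theorem ZMod.exists_eq_mul_of_castHom_eq_zero {a b : ℕ} (h : a ∣ b) {x : ZMod b}
    (hx : ZMod.castHom h (ZMod a) x = 0) : ∃ y, x = a * y := by
  obtain ⟨z, rfl⟩ := ZMod.intCast_surjective x
  rw [map_intCast, ZMod.intCast_zmod_eq_zero_iff_dvd] at hx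
  obtain ⟨y, rfl⟩ := hx
  exact ⟨y, by push_cast; rfl⟩

theorem Polynomial.map_aeval_int {R S : Type*} [CommRing R] [CommRing S] (φ : R →+* S)
    (f : Polynomial ℤ) (x : R) :
    φ (Polynomial.aeval x f) = Polynomial.aeval (φ x) f :=
  (Polynomial.aeval_algHom_apply φ.toIntAlgHom x f).symm

theorem semiconj_castHom_polyMap {a b : ℕ} (h : a ∣ b) (f : Polynomial ℤ) :
    Function.Semiconj (ZMod.castHom h (ZMod a)) (polyMap b f) (polyMap a f) :=
  Polynomial.map_aeval_int _ f

theorem castHom_multiplier {a b : ℕ} (h : a ∣ b) (f : Polynomial ℤ) (k : ℕ) (x : ZMod b) :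
    ZMod.castHom h (ZMod a) (multiplier b f k x) =
      multiplier a f k (ZMod.castHom h (ZMod a) x) := by
  simp only [multiplier, map_prod, Polynomial.map_aeval_int,
    ((semiconj_castHom_polyMap h f).iterate_right _).eq]

/-- First-order expansion of the iterates of a polynomial map along a square-zero increment. -/
theorem polyMap_iterate_add_of_sq_eq_zero {m : ℕ} (f : Polynomial ℤ) (k : ℕ) (x e : ZMod m)
    (he : e ^ 2 = 0) :
    (polyMap m f)^[k] (x + e) = (polyMap m f)^[k] x + multiplier m f k x * e := by
  induction k with
  | zero => simp [multiplier]
  | succ k ih =>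
    rw [Function.iterate_succ_apply', Function.iterate_succ_apply', ih, polyMap,
      Polynomial.aeval_add_of_sq_eq_zero _ _ _ (by rw [mul_pow, he, mul_zero]), multiplier,
      multiplier, Finset.prod_range_succ]
    simp only [polyMap]
    ring

/-- If `v ∈ ZMod p^n` is a periodic point of `F_{p^n}` of minimal period `k`
with reduced multiplier `λ̄(v) = 0` in `ZMod p`, then there is exactly one lift
`w ∈ ZMod p^{n+1}` of `v` that is a periodic point of `F_{p^{n+1}}`, and this `w` has
minimal period `k`. -/
theorem lift_cycle_multiplier_zero (p : ℕ) (hp : p.Prime) (n : ℕ) (hn : n ≠ 0)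
    (f : Polynomial ℤ) (k : ℕ) (v : ZMod (p ^ n))
    (hv : v ∈ Function.periodicPts (polyMap (p ^ n) f))
    (hk : Function.minimalPeriod (polyMap (p ^ n) f) v = k)
    (hlam : ZMod.castHom (dvd_pow_self p hn) (ZMod p) (multiplier (p ^ n) f k v) = 0) :
    (∃! w : ZMod (p ^ (n + 1)),
      ZMod.castHom (pow_dvd_pow p (Nat.le_succ n)) (ZMod (p ^ n)) w = v ∧
        w ∈ Function.periodicPts (polyMap (p ^ (n + 1)) f)) ∧
    (∀ w : ZMod (p ^ (n + 1)),
      ZMod.castHom (pow_dvd_pow p (Nat.le_succ n)) (ZMod (p ^ n)) w = v →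
      w ∈ Function.periodicPts (polyMap (p ^ (n + 1)) f) →
      Function.minimalPeriod (polyMap (p ^ (n + 1)) f) w = k) := by
  subst hk
  refine existsUnique_periodic_lift_of_collapse (semiconj_castHom_polyMap _ f)
    (ZMod.castHom_surjective _) hv fun x y hx hy => ?_
  obtain ⟨t, ht⟩ := ZMod.exists_eq_mul_of_castHom_eq_zero (pow_dvd_pow p (Nat.le_succ n))
    (x := x - y) (by rw [map_sub, hx, hy, sub_self])
  obtain ⟨s, hs⟩ := ZMod.exists_eq_mul_of_castHom_eq_zero
    (dvd_pow_self p (Nat.succ_ne_zero n))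
    (x := multiplier (p ^ (n + 1)) f (Function.minimalPeriod (polyMap (p ^ n) f) v) y) (by
      rw [← hlam]
      nth_rewrite 3 [← hy]
      rw [← castHom_multiplier, ← RingHom.comp_apply]
      exact congrArg (fun φ : _ →+* ZMod p => φ _) (Subsingleton.elim _ _))
  have hp0 : (p : ZMod (p ^ (n + 1))) ^ (n + 1) = 0 := by
    exact_mod_cast ZMod.natCast_self (p ^ (n + 1))
  have hsq : (x - y) ^ 2 = 0 := by
    obtain ⟨r, rfl⟩ := Nat.exists_eq_add_one_of_ne_zero hn
    rw [ht]
    push_cast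
    linear_combination (p : ZMod (p ^ (r + 1 + 1))) ^ r * t ^ 2 * hp0
  rw [← add_sub_cancel y x, polyMap_iterate_add_of_sq_eq_zero f _ y _ hsq, hs, ht]
  push_cast
  linear_combination s * t * hp0
end

section
/- Let p be a prime, n ≥ 1, f ∈ ℤ[X], and let v ∈ ZMod p^n be a periodic point of F_{p^n} of minimal period k with λ̄(v) = 1 in ZMod p and r_v = 0. Then every lift w ∈ ZMod p^{n+1} of v is a periodic point of F_{p^{n+1}} of minimal period k (so the lifted graph of the cycle of v consists of p cycles of size k). -/
/-- `f^{∘k} : ℤ → ℤ`, the `k`-fold iterate of the polynomial map of `f`. -/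
noncomputable def polyIter (f : Polynomial ℤ) (k : ℕ) : ℤ → ℤ :=
  (fun x : ℤ => Polynomial.eval x f)^[k]

theorem polyMap_intCast (m : ℕ) (f : Polynomial ℤ) (a : ℤ) :
    polyMap m f (a : ZMod m) = ((Polynomial.eval a f : ℤ) : ZMod m) := by
  simpa [polyMap] using Polynomial.aeval_algebraMap_apply_eq_algebraMap_eval (A := ZMod m) a f

theorem polyMap_iterate_intCast (m : ℕ) (f : Polynomial ℤ) (j : ℕ) (a : ℤ) :
    (polyMap m f)^[j] (a : ZMod m) = (polyIter f j a : ZMod m) :=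
  ((Function.Semiconj.iterate_right
    (f := fun x : ℤ => (x : ZMod m)) (fun x => (polyMap_intCast m f x).symm) j) a).symm

theorem castHom_polyMap {m l : ℕ} (h : l ∣ m) (f : Polynomial ℤ) :
    Function.Semiconj (ZMod.castHom h (ZMod l)) (polyMap m f) (polyMap l f) := by
  intro x
  obtain ⟨a, rfl⟩ := ZMod.intCast_surjective x
  simp only [polyMap_intCast, map_intCast]

theorem multiplier_intCast (m : ℕ) (f : Polynomial ℤ) (k : ℕ) (a : ℤ) :
    multiplier m f k (a : ZMod m) =
      ((∏ i ∈ Finset.range k, (Polynomial.derivative f).eval (polyIter f i a) : ℤ) :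
        ZMod m) := by
  rw [multiplier, Int.cast_prod]
  refine Finset.prod_congr rfl fun i _ => ?_
  rw [polyMap_iterate_intCast]
  exact polyMap_intCast m _ _

/-- First-order Taylor expansion of an iterate of a polynomial map, with remainder divisible
by the square of the increment. -/
theorem sq_dvd_polyIter_add_sub (f : Polynomial ℤ) (k : ℕ) (a h : ℤ) :
    h ^ 2 ∣ polyIter f k (a + h) - (polyIter f k a +
      (∏ i ∈ Finset.range k, (Polynomial.derivative f).eval (polyIter f i a)) * h) := by
  induction k with
  | zero => simp [polyIter]
  | succ k ih =>
    obtain ⟨c, hc⟩ := ih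
    have hs : ∀ x, polyIter f (k + 1) x = f.eval (polyIter f k x) := fun x => by
      simp only [polyIter, Function.iterate_succ_apply']
    rw [hs, hs, Finset.prod_range_succ]
    set y := polyIter f k a
    set D := ∏ i ∈ Finset.range k, (Polynomial.derivative f).eval (polyIter f i a)
    have hy : polyIter f k (a + h) = y + (D * h + h ^ 2 * c) := by linear_combination hc
    obtain ⟨e, he⟩ := Polynomial.binomExpansion f y (D * h + h ^ 2 * c)
    rw [hy, he]
    exact ⟨(Polynomial.derivative f).eval y * c + e * (D + h * c) ^ 2, by ring⟩

/-- Let `v ∈ ZMod p^n` be a periodic point of `F_{p^n}` of minimal period `k`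
with `λ̄(v) = 1` in `ZMod p` and `r_v = 0` (where `r_v ∈ [0, p)` is determined by
`f^{∘k}(a_v) ≡ a_v + r_v·p^n (mod p^{n+1})` for the representative `a_v ∈ [0, p^n)` of `v`).
Then every lift `w ∈ ZMod p^{n+1}` of `v` is a periodic point of `F_{p^{n+1}}` of minimal
period `k`. -/
theorem lift_cycle_multiplier_one_r_zero (p : ℕ) (hp : p.Prime) (n : ℕ) (hn : n ≠ 0)
    (f : Polynomial ℤ) (k : ℕ) (v : ZMod (p ^ n))
    (hv : v ∈ Function.periodicPts (polyMap (p ^ n) f))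
    (hk : Function.minimalPeriod (polyMap (p ^ n) f) v = k)
    (hlam : ZMod.castHom (dvd_pow_self p hn) (ZMod p) (multiplier (p ^ n) f k v) = 1)
    (r : ℕ) (hrp : r < p)
    (hr : polyIter f k (v.val : ℤ) ≡
      (v.val : ℤ) + (r : ℤ) * (p : ℤ) ^ n [ZMOD (p : ℤ) ^ (n + 1)])
    (hr0 : r = 0) :
    ∀ w : ZMod (p ^ (n + 1)),
      ZMod.castHom (pow_dvd_pow p (Nat.le_succ n)) (ZMod (p ^ n)) w = v →
      w ∈ Function.periodicPts (polyMap (p ^ (n + 1)) f) ∧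
        Function.minimalPeriod (polyMap (p ^ (n + 1)) f) w = k := by
  have : NeZero (p ^ n) := ⟨pow_ne_zero n hp.ne_zero⟩
  subst hr0
  intro w hw
  obtain ⟨b, rfl⟩ := ZMod.intCast_surjective w
  have hkpos : 0 < k := hk ▸ Function.minimalPeriod_pos_of_mem_periodicPts hv
  have hva : (((v.val : ℤ)) : ZMod (p ^ n)) = v := by simp
  set a : ℤ := (v.val : ℤ)
  have hab : ((p ^ n : ℕ) : ℤ) ∣ b - a := by
    rw [← ZMod.intCast_eq_intCast_iff_dvd_sub, hva, ← hw, map_intCast]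
  obtain ⟨t, ht⟩ := hab
  rw [← hva, multiplier_intCast, map_intCast] at hlam
  set D : ℤ := ∏ i ∈ Finset.range k, (Polynomial.derivative f).eval (polyIter f i a) with hD
  have hD1 : (p : ℤ) ∣ D - 1 := by
    rw [← ZMod.intCast_eq_intCast_iff_dvd_sub, hlam, Int.cast_one]
  obtain ⟨s, hs⟩ := hD1
  obtain ⟨u, hu⟩ := (Int.modEq_iff_dvd.mp hr.symm)
  obtain ⟨c, hc⟩ := sq_dvd_polyIter_add_sub f k a ((p : ℤ) ^ n * t)
  rw [← hD] at hc
  push_cast at ht hu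
  obtain rfl : b = a + (p : ℤ) ^ n * t := by linear_combination ht
  obtain ⟨l, rfl⟩ := Nat.exists_eq_succ_of_ne_zero hn
  have hper : Function.IsPeriodicPt (polyMap (p ^ (l + 1 + 1)) f) k
      ((a + (p : ℤ) ^ (l + 1) * t : ℤ) : ZMod (p ^ (l + 1 + 1))) := by
    rw [Function.IsPeriodicPt, Function.IsFixedPt, polyMap_iterate_intCast, eq_comm,
      ZMod.intCast_eq_intCast_iff_dvd_sub]
    refine ⟨u + s * t + (p : ℤ) ^ l * t ^ 2 * c, ?_⟩
    push_cast
    simp only [Nat.succ_eq_add_one] at *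
    linear_combination hc + hu + (p : ℤ) ^ (l + 1) * t * hs
  refine ⟨Function.mk_mem_periodicPts hkpos hper,
    Nat.dvd_antisymm hper.minimalPeriod_dvd ?_⟩
  rw [← hk, ← hw]
  exact ((Function.isPeriodicPt_minimalPeriod _ _).map
    (castHom_polyMap (pow_dvd_pow p (Nat.le_succ _)) f)).minimalPeriod_dvd
end

section
/- Let p be a prime, n ≥ 1, f ∈ ℤ[X], and let v ∈ ZMod p^n be a periodic point of F_{p^n} of minimal period k whose reduced multiplier λ̄(v) ∈ ZMod p satisfies λ̄(v) ≠ 0 and λ̄(v) ≠ 1, and let m be the multiplicative order of λ̄(v) in (ZMod p)ˣ. Then every lift w ∈ ZMod p^{n+1} of v is a periodic point of F_{p^{n+1}}, exactly one such lift has minimal period k, and the remaining p − 1 lifts each have minimal period k·m (so the lifted graph of the cycle of v consists of one cycle of size k and (p−1)/m cycles of size m·k). -/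
theorem map_polyMap {a b : ℕ} (φ : ZMod a →+* ZMod b) (f : Polynomial ℤ) (x : ZMod a) :
    φ (polyMap a f x) = polyMap b f (φ x) :=
  (Polynomial.aeval_algHom_apply φ.toIntAlgHom x f).symm

theorem semiconj_polyMap {a b : ℕ} (φ : ZMod a →+* ZMod b) (f : Polynomial ℤ) :
    Function.Semiconj φ (polyMap a f) (polyMap b f) :=
  map_polyMap φ f

theorem map_multiplier {a b : ℕ} (φ : ZMod a →+* ZMod b) (f : Polynomial ℤ) (k : ℕ)
    (x : ZMod a) : φ (multiplier a f k x) = multiplier b f k (φ x) := by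
  simp only [multiplier, map_prod]
  refine Finset.prod_congr rfl fun i _ => ?_
  rw [← (semiconj_polyMap φ f).iterate_right i x]
  exact map_polyMap φ (Polynomial.derivative f) _

/-- First-order Taylor expansion of an iterate along a square-zero increment. -/
theorem polyMap_iterate_add {a : ℕ} (f : Polynomial ℤ) (x ε : ZMod a) (hε : ε ^ 2 = 0) (k : ℕ) :
    (polyMap a f)^[k] (x + ε) = (polyMap a f)^[k] x + multiplier a f k x * ε := by
  induction k with
  | zero => simp [multiplier]
  | succ k ih =>
    have hsq : (multiplier a f k x * ε) ^ 2 = 0 := by rw [mul_pow, hε, mul_zero]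
    rw [Function.iterate_succ_apply', Function.iterate_succ_apply', ih]
    refine (Polynomial.aeval_add_of_sq_eq_zero f _ _ hsq).trans ?_
    rw [multiplier, multiplier, Finset.prod_range_succ, ← polyMap]
    ring

/-- Near a point fixed by the `k`-th iterate, the `k * j`-th iterate multiplies a square-zero
increment by the `j`-th power of the multiplier. -/
theorem polyMap_iterate_mul_add {a : ℕ} (f : Polynomial ℤ) {x : ZMod a} {k : ℕ}
    (hx : (polyMap a f)^[k] x = x) (ε : ZMod a) (hε : ε ^ 2 = 0) (j : ℕ) :
    (polyMap a f)^[k * j] (x + ε) = x + multiplier a f k x ^ j * ε := by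
  induction j with
  | zero => simp
  | succ j ih =>
    have hsq : (multiplier a f k x ^ j * ε) ^ 2 = 0 := by rw [mul_pow, hε, mul_zero]
    rw [Nat.mul_succ, Nat.add_comm, Function.iterate_add_apply, ih,
      polyMap_iterate_add f x _ hsq, hx]
    ring

theorem prime_pow_mul_eq_zero_iff {p n : ℕ} (hp : p.Prime) (a : ZMod (p ^ (n + 1))) :
    (p : ZMod (p ^ (n + 1))) ^ n * a = 0 ↔
      ZMod.castHom (dvd_pow_self p n.succ_ne_zero) (ZMod p) a = 0 := by
  obtain ⟨z, rfl⟩ := ZMod.intCast_surjective a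
  have hpn : (p : ℤ) ^ n ≠ 0 := pow_ne_zero _ (by exact_mod_cast hp.ne_zero)
  rw [map_intCast, ZMod.intCast_zmod_eq_zero_iff_dvd, ← Int.cast_natCast (R := ZMod _) p,
    ← Int.cast_pow, ← Int.cast_mul, ZMod.intCast_zmod_eq_zero_iff_dvd]
  push_cast
  rw [pow_succ, mul_dvd_mul_iff_left hpn]

theorem exists_eq_add_of_castHom_eq {p n : ℕ} {x y : ZMod (p ^ (n + 1))}
    (h : ZMod.castHom (pow_dvd_pow p (Nat.le_succ n)) (ZMod (p ^ n)) x =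
      ZMod.castHom (pow_dvd_pow p (Nat.le_succ n)) (ZMod (p ^ n)) y) :
    ∃ t, x = y + (p : ZMod (p ^ (n + 1))) ^ n * t := by
  obtain ⟨a, rfl⟩ := ZMod.intCast_surjective x
  obtain ⟨b, rfl⟩ := ZMod.intCast_surjective y
  rw [map_intCast, map_intCast, ← sub_eq_zero, ← Int.cast_sub,
    ZMod.intCast_zmod_eq_zero_iff_dvd] at h
  obtain ⟨c, hc⟩ := h
  refine ⟨c, ?_⟩
  rw [← sub_eq_iff_eq_add', ← Int.cast_sub, hc]
  push_cast
  rfl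

/-- Let `v ∈ ZMod p^n` be a periodic point of `F_{p^n}` of minimal period `k`
with `λ̄(v) ≠ 0, 1` in `ZMod p`, and let `m` be the multiplicative order of `λ̄(v)`. Then every
lift `w ∈ ZMod p^{n+1}` of `v` is a periodic point of `F_{p^{n+1}}`, exactly one such lift has
minimal period `k`, and every other lift has minimal period `k·m`. -/
theorem lift_cycle_multiplier_general (p : ℕ) (hp : p.Prime) (n : ℕ) (hn : n ≠ 0)
    (f : Polynomial ℤ) (k : ℕ) (v : ZMod (p ^ n))
    (hv : v ∈ Function.periodicPts (polyMap (p ^ n) f))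
    (hk : Function.minimalPeriod (polyMap (p ^ n) f) v = k)
    (hlam0 : ZMod.castHom (dvd_pow_self p hn) (ZMod p) (multiplier (p ^ n) f k v) ≠ 0)
    (hlam1 : ZMod.castHom (dvd_pow_self p hn) (ZMod p) (multiplier (p ^ n) f k v) ≠ 1)
    (m : ℕ)
    (hm : m = orderOf (ZMod.castHom (dvd_pow_self p hn) (ZMod p) (multiplier (p ^ n) f k v))) :
    (∀ w : ZMod (p ^ (n + 1)),
      ZMod.castHom (pow_dvd_pow p (Nat.le_succ n)) (ZMod (p ^ n)) w = v →
      w ∈ Function.periodicPts (polyMap (p ^ (n + 1)) f)) ∧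
    (∃! w : ZMod (p ^ (n + 1)),
      ZMod.castHom (pow_dvd_pow p (Nat.le_succ n)) (ZMod (p ^ n)) w = v ∧
        Function.minimalPeriod (polyMap (p ^ (n + 1)) f) w = k) ∧
    (∀ w : ZMod (p ^ (n + 1)),
      ZMod.castHom (pow_dvd_pow p (Nat.le_succ n)) (ZMod (p ^ n)) w = v →
      Function.minimalPeriod (polyMap (p ^ (n + 1)) f) w ≠ k →
      Function.minimalPeriod (polyMap (p ^ (n + 1)) f) w = k * m) := by
  have : Fact p.Prime := ⟨hp⟩
  set π := ZMod.castHom (pow_dvd_pow p (Nat.le_succ n)) (ZMod (p ^ n))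
  set ρ := ZMod.castHom (dvd_pow_self p n.succ_ne_zero) (ZMod p)
  set l := ZMod.castHom (dvd_pow_self p hn) (ZMod p) (multiplier (p ^ n) f k v)
  set F := polyMap (p ^ (n + 1)) f
  set q : ZMod (p ^ (n + 1)) := (p : ZMod (p ^ (n + 1))) ^ n
  have hπ : Function.Semiconj π F (polyMap (p ^ n) f) := semiconj_polyMap π f
  have hk0 : 0 < k := hk ▸ Function.minimalPeriod_pos_of_mem_periodicPts hv
  have hq : q ^ 2 = 0 := by
    rw [← pow_mul]
    refine pow_eq_zero_of_le (show n + 1 ≤ n * 2 by omega) ?_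
    exact_mod_cast ZMod.natCast_self (p ^ (n + 1))
  have hsq (t : ZMod (p ^ (n + 1))) : (q * t) ^ 2 = 0 := by rw [mul_pow, hq, zero_mul]
  have hπq (t : ZMod (p ^ (n + 1))) : π (q * t) = 0 := by
    have : (p : ZMod (p ^ n)) ^ n = 0 := by exact_mod_cast ZMod.natCast_self (p ^ n)
    rw [map_mul, map_pow, map_natCast, this, zero_mul]
  have hzero (t : ZMod (p ^ (n + 1))) : q * t = 0 ↔ ρ t = 0 := prime_pow_mul_eq_zero_iff hp t
  have hmult (w : ZMod (p ^ (n + 1))) (hw : π w = v) :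
      ρ (multiplier (p ^ (n + 1)) f k w) = l := by
    have hcomp : ρ = (ZMod.castHom (dvd_pow_self p hn) (ZMod p)).comp π := Subsingleton.elim _ _
    rw [hcomp, RingHom.comp_apply, map_multiplier, hw]
  have hdvd (w : ZMod (p ^ (n + 1))) (hw : π w = v) : k ∣ Function.minimalPeriod F w := by
    rw [← hk, ← hw]
    exact ((Function.isPeriodicPt_minimalPeriod F w).map hπ).minimalPeriod_dvd
  obtain ⟨w₀, hw₀, hfix⟩ : ∃ w, π w = v ∧ F^[k] w = w := by
    obtain ⟨x, hx⟩ := ZMod.castHom_surjective (pow_dvd_pow p (Nat.le_succ n)) v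
    have hper : π (F^[k] x) = π x := by
      rw [hπ.iterate_right k x, hx, ← hk]
      exact Function.isPeriodicPt_minimalPeriod _ v
    obtain ⟨c, hc⟩ := exists_eq_add_of_castHom_eq hper
    obtain ⟨t, ht⟩ := ZMod.castHom_surjective (dvd_pow_self p n.succ_ne_zero) (ρ c / (1 - l))
    refine ⟨x + q * t, by rw [map_add, hπq, add_zero, hx], ?_⟩
    rw [polyMap_iterate_add f x _ (hsq t), ← sub_eq_zero]
    have hl : 1 - l ≠ 0 := sub_ne_zero.2 hlam1.symm
    have hlin : q * (c + multiplier (p ^ (n + 1)) f k x * t - t) = 0 := by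
      rw [hzero, map_sub, map_add, map_mul, hmult x hx, show ρ t = _ from ht]
      field_simp
      ring
    rw [show (polyMap (p ^ (n + 1)) f)^[k] x = x + q * c from hc]
    linear_combination hlin
  have hperiodic (t : ZMod (p ^ (n + 1))) (j : ℕ) :
      Function.IsPeriodicPt F (k * j) (w₀ + q * t) ↔ (l ^ j - 1) * ρ t = 0 := by
    rw [Function.IsPeriodicPt, Function.IsFixedPt, polyMap_iterate_mul_add f hfix _ (hsq t),
      add_right_inj, ← sub_eq_zero,
      show multiplier (p ^ (n + 1)) f k w₀ ^ j * (q * t) - q * t =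
        q * ((multiplier (p ^ (n + 1)) f k w₀ ^ j - 1) * t) by ring,
      hzero, map_mul, map_sub, map_pow, map_one, hmult w₀ hw₀]
  have hlift (w : ZMod (p ^ (n + 1))) (hw : π w = v) : ∃ t, w = w₀ + q * t :=
    exists_eq_add_of_castHom_eq (hw.trans hw₀.symm)
  have hm0 : 0 < m := hm ▸ orderOf_pos_iff.2 (isOfFinOrder_iff_pow_eq_one.2
    ⟨p - 1, Nat.sub_pos_of_lt hp.one_lt, ZMod.pow_card_sub_one_eq_one hlam0⟩)
  have hkm (t : ZMod (p ^ (n + 1))) : Function.IsPeriodicPt F (k * m) (w₀ + q * t) := by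
    rw [hperiodic, hm, pow_orderOf_eq_one, sub_self, zero_mul]
  have hmin : Function.minimalPeriod F w₀ = k :=
    Nat.dvd_antisymm (Function.IsPeriodicPt.minimalPeriod_dvd hfix) (hdvd w₀ hw₀)
  refine ⟨fun w hw => ?_, ⟨w₀, ⟨hw₀, hmin⟩, ?_⟩, fun w hw hne => ?_⟩
  · obtain ⟨t, rfl⟩ := hlift w hw
    exact ⟨k * m, Nat.mul_pos hk0 hm0, hkm t⟩
  · rintro w ⟨hw, hwk⟩
    obtain ⟨t, rfl⟩ := hlift w hw
    have h := Function.isPeriodicPt_minimalPeriod F (w₀ + q * t)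
    rw [hwk, ← mul_one k, hperiodic, pow_one] at h
    rw [(hzero t).2 ((mul_eq_zero.1 h).resolve_left (sub_ne_zero.2 hlam1)), add_zero]
  · obtain ⟨t, rfl⟩ := hlift w hw
    have ht : ρ t ≠ 0 := fun h => hne (by rw [(hzero t).2 h, add_zero, hmin])
    refine Nat.dvd_antisymm (hkm t).minimalPeriod_dvd ?_
    obtain ⟨j, hj⟩ := hdvd _ hw
    have h := Function.isPeriodicPt_minimalPeriod F (w₀ + q * t)
    rw [hj, hperiodic] at h
    rw [hj, hm]
    exact mul_dvd_mul_left k (orderOf_dvd_of_pow_eq_one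
      (sub_eq_zero.1 ((mul_eq_zero.1 h).resolve_right ht)))
end

section
/- Let p > 3 be a prime, f ∈ ℤ[X], and let v ∈ ZMod p be a periodic point of F_p of minimal period k with λ̄(v) = 1 in ZMod p. Suppose for some N > 1 there is a periodic point w_N ∈ ZMod p^N of F_{p^N} of minimal period k·p whose image under the projection ZMod p^N → ZMod p lies on the cycle of v. Then for every n ≥ N, every periodic point w ∈ ZMod p^n of F_{p^n} whose image under the projection ZMod p^n → ZMod p^N lies on the cycle of w_N has minimal period k·p^{n−N+1}. -/
theorem intCast_iterate_eval (m : ℕ) (f : Polynomial ℤ) (i : ℕ) (x : ℤ) :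
    (((fun y => f.eval y)^[i] x : ℤ) : ZMod m) = (polyMap m f)^[i] (x : ZMod m) := by
  refine Function.Semiconj.iterate_right (f := fun y : ℤ => (y : ZMod m)) (fun y => ?_) i x
  simpa [polyMap] using (Polynomial.aeval_algebraMap_apply (ZMod m) y f).symm

theorem isPeriodicPt_intCast_iff (m : ℕ) (f : Polynomial ℤ) (i : ℕ) (x : ℤ) :
    Function.IsPeriodicPt (polyMap m f) i (x : ZMod m) ↔
      (m : ℤ) ∣ (fun y => f.eval y)^[i] x - x := by
  rw [Function.IsPeriodicPt, Function.IsFixedPt, ← intCast_iterate_eval,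
    ← ZMod.intCast_zmod_eq_zero_iff_dvd, Int.cast_sub, sub_eq_zero]

theorem eval_iterate_comp_X {R : Type*} [CommSemiring R] (f : Polynomial R) (k : ℕ) (x : R) :
    (f.comp^[k] Polynomial.X).eval x = (fun y => f.eval y)^[k] x := by
  rw [Polynomial.iterate_comp_eval, Polynomial.eval_X]

theorem eval_derivative_iterate_comp_X {R : Type*} [CommSemiring R] (f : Polynomial R)
    (k : ℕ) (x : R) :
    (f.comp^[k] Polynomial.X).derivative.eval x =
      ∏ i ∈ Finset.range k, f.derivative.eval ((fun y => f.eval y)^[i] x) := by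
  induction k with
  | zero => simp
  | succ k ih =>
    rw [Function.iterate_succ_apply', Polynomial.derivative_comp, Polynomial.eval_mul, ih,
      Polynomial.eval_comp, eval_iterate_comp_X, Finset.prod_range_succ]

theorem two_mul_sum_range_id (n : ℕ) :
    2 * ∑ j ∈ Finset.range n, (j : ℤ) = n * (n - 1) := by
  induction n with
  | zero => simp
  | succ n ih => rw [Finset.sum_range_succ, mul_add, ih]; push_cast; ring

theorem six_mul_sum_range_sq (n : ℕ) :
    6 * ∑ j ∈ Finset.range n, (j : ℤ) ^ 2 = n * ((n - 1) * (2 * n - 1)) := by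
  induction n with
  | zero => simp
  | succ n ih => rw [Finset.sum_range_succ, mul_add, ih]; push_cast; ring

theorem prime_dvd_sum_range_id {p : ℕ} (hp : p.Prime) (hp3 : 3 < p) :
    (p : ℤ) ∣ ∑ j ∈ Finset.range p, (j : ℤ) := by
  have h : (p : ℤ) ∣ 2 * ∑ j ∈ Finset.range p, (j : ℤ) :=
    ⟨_, two_mul_sum_range_id p⟩
  refine ((Nat.prime_iff_prime_int.mp hp).dvd_or_dvd h).resolve_left fun h2 => ?_
  have := Int.le_of_dvd (by norm_num) h2
  omega

theorem prime_dvd_sum_range_sq {p : ℕ} (hp : p.Prime) (hp3 : 3 < p) :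
    (p : ℤ) ∣ ∑ j ∈ Finset.range p, (j : ℤ) ^ 2 := by
  have hp' := Nat.prime_iff_prime_int.mp hp
  have h : (p : ℤ) ∣ 2 * 3 * ∑ j ∈ Finset.range p, (j : ℤ) ^ 2 :=
    ⟨_, by norm_num; exact six_mul_sum_range_sq p⟩
  refine (hp'.dvd_or_dvd h).resolve_left fun h6 => ?_
  rcases hp'.dvd_or_dvd h6 with h2 | h2
  · have := Int.le_of_dvd (by norm_num) h2
    omega
  · have := Int.le_of_dvd (by norm_num) h2
    omega

/-- Second order Taylor expansion of a polynomial map with a cubic remainder. -/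
theorem exists_eval_add_eq_cubic {R : Type*} [CommRing R] (f : Polynomial R) (x : R) :
    ∃ c : R, ∀ y, ∃ t, f.eval (x + y) =
      f.eval x + f.derivative.eval x * y + c * y ^ 2 + t * y ^ 3 := by
  set P := Polynomial.taylor x f with hP
  refine ⟨P.coeff 2, fun y => ⟨P.divX.divX.divX.eval y, ?_⟩⟩
  have h0 : f.eval (x + y) = P.eval y := by rw [hP, Polynomial.taylor_eval, add_comm]
  have h1 (Q : Polynomial R) : Q.eval y = Q.divX.eval y * y + Q.coeff 0 := by
    conv_lhs => rw [← Polynomial.divX_mul_X_add Q]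
    simp
  rw [h0, h1 P, h1 P.divX, h1 P.divX.divX]
  simp only [Polynomial.coeff_divX, ← Polynomial.taylor_coeff_zero x f,
    ← Polynomial.taylor_coeff_one x f, ← hP]
  ring

/-- If `g` moves `x` by a multiple of exactly `p ^ m` and has derivative `1` modulo `p` at `x`,
then the `p`-th iterate of `g` moves `x` by a multiple of exactly `p ^ (m + 1)`. -/
theorem exists_iterate_prime_eq {p : ℕ} (hp : p.Prime) (hp3 : 3 < p) (g : Polynomial ℤ) (x : ℤ)
    {m : ℕ} (hm : 1 ≤ m) {u : ℤ} (hu : ¬ (p : ℤ) ∣ u) (hg : g.eval x = x + p ^ m * u)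
    (hd : (p : ℤ) ∣ g.derivative.eval x - 1) :
    ∃ u' : ℤ, ¬ (p : ℤ) ∣ u' ∧ (fun y => g.eval y)^[p] x = x + p ^ (m + 1) * u' := by
  obtain ⟨l, rfl⟩ := Nat.exists_eq_add_of_le' hm
  obtain ⟨b, hb⟩ := hd
  obtain ⟨c, hc⟩ := exists_eval_add_eq_cubic g x
  have key (i : ℕ) : ∃ t : ℤ, (fun y => g.eval y)^[i] x = x + p ^ (l + 1) *
      (i * u + p * (b * u * ∑ j ∈ Finset.range i, (j : ℤ) +
        c * p ^ l * u ^ 2 * ∑ j ∈ Finset.range i, (j : ℤ) ^ 2) + p ^ 2 * t) := by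
    induction i with
    | zero => exact ⟨0, by simp⟩
    | succ i ih =>
      obtain ⟨t, ht⟩ := ih
      rw [Function.iterate_succ_apply', ht]
      set s := b * u * ∑ j ∈ Finset.range i, (j : ℤ) +
        c * p ^ l * u ^ 2 * ∑ j ∈ Finset.range i, (j : ℤ) ^ 2 with hs
      obtain ⟨r, hr⟩ := hc (p ^ (l + 1) * (i * u + p * s + p ^ 2 * t))
      refine ⟨t + b * (s + p * t) + c * p ^ l * (2 * i * u * (s + p * t) + p * (s + p * t) ^ 2)
        + r * (p ^ l) ^ 2 * (i * u + p * s + p ^ 2 * t) ^ 3, ?_⟩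
      rw [hr, hg, eq_add_of_sub_eq hb, Finset.sum_range_succ, Finset.sum_range_succ]
      rw [show b * u * (∑ j ∈ Finset.range i, (j : ℤ) + i) +
        c * p ^ l * u ^ 2 * (∑ j ∈ Finset.range i, (j : ℤ) ^ 2 + i ^ 2) =
          s + b * u * i + c * p ^ l * u ^ 2 * i ^ 2 by rw [hs]; ring]
      push_cast
      ring
  obtain ⟨t, ht⟩ := key p
  obtain ⟨s₁, h₁⟩ := prime_dvd_sum_range_id hp hp3
  obtain ⟨s₂, h₂⟩ := prime_dvd_sum_range_sq hp hp3
  refine ⟨u + p * (b * u * s₁ + c * p ^ l * u ^ 2 * s₂ + t), fun h => hu ?_, ?_⟩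
  · exact (dvd_add_left (dvd_mul_right _ _)).mp h
  · rw [ht, h₁, h₂]
    ring

theorem dvd_iterate_eval_sub {d : ℤ} (g : Polynomial ℤ) (x : ℤ) (h : d ∣ g.eval x - x) (i : ℕ) :
    d ∣ (fun y => g.eval y)^[i] x - x := by
  induction i with
  | zero => simp
  | succ i ih =>
    rw [Function.iterate_succ_apply']
    have := dvd_add (ih.trans (Polynomial.sub_dvd_eval_sub _ _ g)) h
    simpa using this

theorem exists_iterate_prime_pow_eq {p : ℕ} (hp : p.Prime) (hp3 : 3 < p) (g : Polynomial ℤ)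
    (x : ℤ) {m : ℕ} (hm : 1 ≤ m) {u : ℤ} (hu : ¬ (p : ℤ) ∣ u) (hg : g.eval x = x + p ^ m * u)
    (hd : (p : ℤ) ∣ g.derivative.eval x - 1) (j : ℕ) :
    ∃ u' : ℤ, ¬ (p : ℤ) ∣ u' ∧ (fun y => g.eval y)^[p ^ j] x = x + p ^ (m + j) * u' := by
  induction j generalizing g m u with
  | zero => exact ⟨u, hu, by simpa using hg⟩
  | succ j ih =>
    obtain ⟨u', hu', h⟩ := exists_iterate_prime_eq hp hp3 g x hm hu hg hd
    have hpx : (p : ℤ) ∣ g.eval x - x := by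
      rw [hg, add_sub_cancel_left]
      exact (dvd_pow_self _ (by omega)).mul_right _
    have hd' : (p : ℤ) ∣ (g.comp^[p] Polynomial.X).derivative.eval x - 1 := by
      rw [eval_derivative_iterate_comp_X, ← ZMod.intCast_zmod_eq_zero_iff_dvd, Int.cast_sub,
        Int.cast_prod, sub_eq_zero, Int.cast_one]
      refine Finset.prod_eq_one fun i _ => ?_
      have := dvd_add ((dvd_iterate_eval_sub g x hpx i).trans
        (Polynomial.sub_dvd_eval_sub _ _ g.derivative)) hd
      rw [sub_add_sub_cancel, ← ZMod.intCast_zmod_eq_zero_iff_dvd, Int.cast_sub,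
        sub_eq_zero] at this
      simpa using this
    obtain ⟨u'', hu'', h''⟩ := ih (g.comp^[p] Polynomial.X) (m := m + 1) (by omega) hu'
      (by rw [eval_iterate_comp_X, h]) hd'
    refine ⟨u'', hu'', ?_⟩
    simp only [eval_iterate_comp_X] at h''
    rw [pow_succ', Function.iterate_mul]
    rw [show m + (j + 1) = m + 1 + j by ring]
    exact h''

theorem minimalPeriod_polyMap_prime_pow {p : ℕ} (hp : p.Prime) (hp3 : 3 < p) (f : Polynomial ℤ)
    (x : ℤ) {k m : ℕ} (hk : Function.minimalPeriod (polyMap p f) (x : ZMod p) = k)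
    (hm : 1 ≤ m) {u : ℤ} (hu : ¬ (p : ℤ) ∣ u)
    (hf : (fun y => f.eval y)^[k] x = x + p ^ m * u)
    (hd : (p : ℤ) ∣ (f.comp^[k] Polynomial.X).derivative.eval x - 1) {n : ℕ} (hn : m ≤ n) :
    Function.minimalPeriod (polyMap (p ^ n) f) (x : ZMod (p ^ n)) = k * p ^ (n - m) := by
  have hp0 : (p : ℤ) ≠ 0 := by exact_mod_cast hp.ne_zero
  have hiff (j : ℕ) : Function.minimalPeriod (polyMap (p ^ n) f) (x : ZMod (p ^ n)) ∣ k * p ^ j ↔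
      n ≤ m + j := by
    obtain ⟨u', hu', h⟩ := exists_iterate_prime_pow_eq hp hp3 (f.comp^[k] Polynomial.X) x hm hu
      (by rw [eval_iterate_comp_X, hf]) hd j
    simp only [eval_iterate_comp_X] at h
    rw [← Function.isPeriodicPt_iff_minimalPeriod_dvd, isPeriodicPt_intCast_iff,
      Function.iterate_mul]
    change _ ∣ (fun y => (fun y => f.eval y)^[k] y)^[p ^ j] x - x ↔ _
    rw [h, add_sub_cancel_left, Nat.cast_pow]
    refine ⟨fun hdvd => ?_, fun hle => (pow_dvd_pow _ hle).mul_right _⟩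
    by_contra! hlt
    have := (pow_dvd_pow (p : ℤ) (Nat.succ_le_of_lt hlt)).trans hdvd
    rw [pow_succ] at this
    exact hu' ((mul_dvd_mul_iff_left (pow_ne_zero _ hp0)).mp this)
  have hkdvd : k ∣ Function.minimalPeriod (polyMap (p ^ n) f) (x : ZMod (p ^ n)) := by
    have h := Function.isPeriodicPt_minimalPeriod (polyMap (p ^ n) f) (x : ZMod (p ^ n))
    rw [isPeriodicPt_intCast_iff] at h
    conv_lhs => rw [← hk]
    rw [← Function.isPeriodicPt_iff_minimalPeriod_dvd, isPeriodicPt_intCast_iff]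
    refine dvd_trans ?_ h
    exact_mod_cast dvd_pow_self p (by omega : n ≠ 0)
  obtain ⟨r, hr⟩ := hkdvd
  have hk0 : k ≠ 0 := by
    rintro rfl
    have hz : (p : ℤ) ^ m * u = 0 := by simpa using hf
    rcases mul_eq_zero.mp hz with h | h
    · exact pow_ne_zero _ hp0 h
    · exact hu (h ▸ dvd_zero _)
  have hiff' (j : ℕ) : r ∣ p ^ j ↔ n ≤ m + j := by
    rw [← hiff, hr, Nat.mul_dvd_mul_iff_left (Nat.pos_of_ne_zero hk0)]
  obtain ⟨s, hs, rfl⟩ := (Nat.dvd_prime_pow hp).mp ((hiff' (n - m)).mpr (by omega))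
  have := (hiff' s).mp dvd_rfl
  rw [hr, show s = n - m by omega]

/-- The multiplier takes the value `1` along a whole cycle as soon as it does at one point. -/
theorem multiplier_iterate_eq_one {p : ℕ} [Fact p.Prime] (f : Polynomial ℤ) {k : ℕ} {v : ZMod p}
    (hk : Function.IsPeriodicPt (polyMap p f) k v) (h : multiplier p f k v = 1) (i : ℕ) :
    multiplier p f k ((polyMap p f)^[i] v) = 1 := by
  induction i with
  | zero => exact h
  | succ i ih =>
    rw [Function.iterate_succ_apply']
    have hki : Function.IsPeriodicPt (polyMap p f) k ((polyMap p f)^[i] v) :=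
      hk.apply_iterate i
    generalize (polyMap p f)^[i] v = z at ih hki ⊢
    have hcomm : multiplier p f k (polyMap p f z) * Polynomial.aeval z f.derivative =
        multiplier p f k z * Polynomial.aeval z f.derivative := by
      have h1 := Finset.prod_range_succ
        (fun i => Polynomial.aeval ((polyMap p f)^[i] z) f.derivative) k
      rw [Finset.prod_range_succ'] at h1
      rw [hki.eq] at h1
      simpa [multiplier] using h1
    rcases ne_or_eq k 0 with hk0 | rfl
    · refine mul_right_cancel₀ (fun hz => ?_) (hcomm.trans (by rw [ih]))
      have : multiplier p f k z = 0 :=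
        Finset.prod_eq_zero (Finset.mem_range.mpr (Nat.pos_of_ne_zero hk0)) hz
      exact one_ne_zero (ih.symm.trans this)
    · simp [multiplier]

theorem intCast_eval_derivative_iterate (p : ℕ) (f : Polynomial ℤ) (k : ℕ) (x : ℤ) :
    (((f.comp^[k] Polynomial.X).derivative.eval x : ℤ) : ZMod p) =
      multiplier p f k (x : ZMod p) := by
  rw [eval_derivative_iterate_comp_X, Int.cast_prod, multiplier]
  refine Finset.prod_congr rfl fun i _ => ?_
  rw [← intCast_iterate_eval]
  simpa using
    (Polynomial.aeval_algebraMap_apply (ZMod p) ((fun y => f.eval y)^[i] x) f.derivative).symm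

/-- Let `p > 3` be prime and `v ∈ ZMod p` a periodic point of `F_p` of
minimal period `k` with `λ̄(v) = 1`. Suppose for some `N > 1` there is a periodic point
`wN ∈ ZMod p^N` of `F_{p^N}` of minimal period `k·p` projecting into the cycle of `v`.
Then for every `n ≥ N`, every periodic point `w ∈ ZMod p^n` of `F_{p^n}` whose projection
to `ZMod p^N` lies on the cycle of `wN` has minimal period `k·p^{n−N+1}`. -/
theorem successive_lifts_multiplier_one (p : ℕ) (hp : p.Prime) (hp3 : 3 < p)
    (f : Polynomial ℤ) (k : ℕ) (v : ZMod p)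
    (hv : v ∈ Function.periodicPts (polyMap p f))
    (hk : Function.minimalPeriod (polyMap p f) v = k)
    (hlam : multiplier p f k v = 1)
    (N : ℕ) (hN : 1 < N) (wN : ZMod (p ^ N))
    (hwNper : wN ∈ Function.periodicPts (polyMap (p ^ N) f))
    (hwNk : Function.minimalPeriod (polyMap (p ^ N) f) wN = k * p)
    (hwNproj : ∃ i < k, (polyMap p f)^[i] v =
      ZMod.castHom (dvd_pow_self p (by omega : N ≠ 0)) (ZMod p) wN) :
    ∀ n : ℕ, ∀ hn : N ≤ n, ∀ w : ZMod (p ^ n),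
      w ∈ Function.periodicPts (polyMap (p ^ n) f) →
      (∃ i < k * p, (polyMap (p ^ N) f)^[i] wN =
        ZMod.castHom (pow_dvd_pow p hn) (ZMod (p ^ N)) w) →
      Function.minimalPeriod (polyMap (p ^ n) f) w = k * p ^ (n - N + 1) := by
  have : Fact p.Prime := ⟨hp⟩
  rintro n hn w - ⟨i, -, hi⟩
  obtain ⟨x, rfl⟩ := ZMod.intCast_surjective w
  rw [map_intCast] at hi
  have hxN : Function.minimalPeriod (polyMap (p ^ N) f) (x : ZMod (p ^ N)) = k * p := by
    rw [← hi, Function.minimalPeriod_apply_iterate hwNper, hwNk]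
  obtain ⟨j, -, hj⟩ := hwNproj
  obtain ⟨y, rfl⟩ := ZMod.intCast_surjective wN
  rw [map_intCast] at hj
  have hxv : (x : ZMod p) = (polyMap p f)^[i + j] v := by
    have := congrArg (ZMod.castHom (dvd_pow_self p (by omega : N ≠ 0)) (ZMod p)) hi
    rw [← intCast_iterate_eval, map_intCast, map_intCast, intCast_iterate_eval, ← hj] at this
    rw [← this, Function.iterate_add_apply]
  have hkx : Function.minimalPeriod (polyMap p f) (x : ZMod p) = k := by
    rw [hxv, Function.minimalPeriod_apply_iterate hv, hk]
  have hk0 : 0 < k := hk ▸ Function.minimalPeriod_pos_of_mem_periodicPts hv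
  have hd : (p : ℤ) ∣ (f.comp^[k] Polynomial.X).derivative.eval x - 1 := by
    rw [← ZMod.intCast_zmod_eq_zero_iff_dvd, Int.cast_sub, intCast_eval_derivative_iterate, hxv,
      multiplier_iterate_eq_one f (hk ▸ Function.isPeriodicPt_minimalPeriod _ _) hlam]
    simp
  have hpx : (p : ℤ) ∣ (fun y => f.eval y)^[k] x - x := by
    rw [← isPeriodicPt_intCast_iff, Function.isPeriodicPt_iff_minimalPeriod_dvd, hkx]
  have hne : (fun y => f.eval y)^[k] x - x ≠ 0 := fun h0 => by
    have : Function.IsPeriodicPt (polyMap (p ^ N) f) k (x : ZMod (p ^ N)) := by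
      rw [isPeriodicPt_intCast_iff, h0]
      exact dvd_zero _
    have := Nat.le_of_dvd hk0 (hxN ▸ this.minimalPeriod_dvd)
    nlinarith
  obtain ⟨m, u, hu, hmu⟩ := WfDvdMonoid.max_power_factor hne
    (Nat.prime_iff_prime_int.mp hp).irreducible
  have hm : 1 ≤ m := by
    by_contra! h
    obtain rfl : m = 0 := by omega
    exact hu (by simpa [hmu] using hpx)
  have hf : (fun y => f.eval y)^[k] x = x + p ^ m * u := by
    rw [← hmu]
    ring
  have hmN : m < N := by
    by_contra! h
    have : Function.IsPeriodicPt (polyMap (p ^ N) f) k (x : ZMod (p ^ N)) := by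
      rw [isPeriodicPt_intCast_iff, hmu, Nat.cast_pow]
      exact (pow_dvd_pow _ h).mul_right _
    have := Nat.le_of_dvd hk0 (hxN ▸ this.minimalPeriod_dvd)
    nlinarith
  have hN1 := minimalPeriod_polyMap_prime_pow hp hp3 f x hkx hm hu hf hd hmN.le
  have hNm : N - m = 1 :=
    Nat.pow_right_injective hp.two_le (by
      simpa using Nat.eq_of_mul_eq_mul_left hk0 (hN1.symm.trans hxN))
  rw [minimalPeriod_polyMap_prime_pow hp hp3 f x hkx hm hu hf hd (hmN.le.trans hn)]
  congr 2
  omega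
end
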